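/- Let k ≥ 1, let p_1, …, p_k ∈ ℝ², and let L = {a + t • v : t ∈ ℝ} and L' = {a' + t • v' : t ∈ ℝ} be two parallel lines in ℝ² (i.e., v' is a nonzero scalar multiple of v). If L' ≠ {2 Σ_{m=1}^{k} (−1)^{k−m} p_m + (−1)^k • x : x ∈ L}, then there is no polygonal curve q_0, q_1, …, q_k in ℝ² with q_0 ∈ L, q_k ∈ L', and p_j = (q_{j−1} + q_j)/2 for j = 1, …, k. -/

import Mathlib

noncomputable section

/-- The plane. -/
abbrev E2 := EuclideanSpace ℝ (Fin 2)

/-- The line through `a` with direction vector `v`. -/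
def LineThrough (a v : E2) : Set E2 := {x : E2 | ∃ t : ℝ, x = a + t • v}

/-- The vertices of a curve with the midpoint property are determined by its initial vertex. -/
theorem vertex_eq_of_midpoint {V : Type*} [AddCommGroup V] [Module ℝ V] {k : ℕ} {p : ℕ → V}
    {q : Fin (k + 1) → V}
    (h : ∀ j : Fin k, p (j.val + 1) = midpoint ℝ (q j.castSucc) (q j.succ)) (n : ℕ)
    (hn : n < k + 1) :
    q ⟨n, hn⟩ = (2 : ℝ) • (∑ m ∈ Finset.Icc 1 n, (-1 : ℝ) ^ (n - m) • p m) +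
      (-1 : ℝ) ^ n • q 0 := by
  induction n with
  | zero => simp
  | succ n ih =>
    have hstep : p (n + 1) = midpoint ℝ (q ⟨n, by omega⟩) (q ⟨n + 1, hn⟩) :=
      h ⟨n, by omega⟩
    have hnext : q ⟨n + 1, hn⟩ = (2 : ℝ) • p (n + 1) - q ⟨n, by omega⟩ := by
      rw [hstep, midpoint_eq_smul_add, smul_smul]
      simp
    have hsum : ∑ m ∈ Finset.Icc 1 n, (-1 : ℝ) ^ (n + 1 - m) • p m =
        -∑ m ∈ Finset.Icc 1 n, (-1 : ℝ) ^ (n - m) • p m := by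
      rw [← Finset.sum_neg_distrib]
      refine Finset.sum_congr rfl fun m hm => ?_
      rw [Nat.sub_add_comm (Finset.mem_Icc.mp hm).2, pow_succ]
      simp
    rw [hnext, ih (by omega), Finset.sum_Icc_succ_top (by omega), hsum, Nat.sub_self, pow_succ]
    module

/-- If an affine map `x ↦ w + e • x` with `e * e = 1` sends a point of a line to a point of a
parallel line, then it maps the first line onto the second. -/
theorem lineThrough_eq_image {a v a' w : E2} {c e s t : ℝ} (hc : c ≠ 0) (he : e * e = 1)
    (h : a' + s • c • v = w + e • (a + t • v)) :
    LineThrough a' (c • v) = (fun x : E2 => w + e • x) '' LineThrough a v := by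
  have ha' : a' = w + e • (a + t • v) - s • c • v := eq_sub_of_add_eq h
  ext x
  constructor
  · rintro ⟨r, rfl⟩
    refine ⟨a + (t + e * ((r - s) * c)) • v, ⟨_, rfl⟩, ?_⟩
    have hcoef : e * (t + e * ((r - s) * c)) = e * t + (r - s) * c := by
      linear_combination ((r - s) * c) * he
    simp only [ha', smul_add, smul_smul, hcoef]
    module
  · rintro ⟨_, ⟨u, rfl⟩, rfl⟩
    refine ⟨s + e * (u - t) / c, ?_⟩
    have hcoef : (s + e * (u - t) / c) * c = s * c + e * (u - t) := by
      field_simp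
    simp only [ha', smul_smul, hcoef]
    module

theorem stmt6 (k : ℕ) (hk : 1 ≤ k) (p : ℕ → E2) (a v a' v' : E2)
    (hv : v ≠ 0) (c : ℝ) (hc : c ≠ 0) (hpar : v' = c • v)
    (hL : LineThrough a' v' ≠
      (fun x : E2 => (2 : ℝ) • (∑ m ∈ Finset.Icc 1 k, ((-1 : ℝ)) ^ (k - m) • p m) +
        ((-1 : ℝ)) ^ k • x) '' LineThrough a v) :
    ¬ ∃ q : Fin (k + 1) → E2,
      q 0 ∈ LineThrough a v ∧ q (Fin.last k) ∈ LineThrough a' v' ∧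
      ∀ j : Fin k, p (j.val + 1) = midpoint ℝ (q j.castSucc) (q j.succ) := by
  rintro ⟨q, ⟨t, h0⟩, ⟨s, hs⟩, hmid⟩
  refine hL ?_
  subst hpar
  have hlast := vertex_eq_of_midpoint hmid k (Nat.lt_succ_self k)
  have hq : q (Fin.last k) = q ⟨k, Nat.lt_succ_self k⟩ := rfl
  rw [← hq, hs, h0] at hlast
  exact lineThrough_eq_image hc (by rw [← mul_pow]; simp) hlast
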